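/- arXiv:math/0012206 — 4 statements merged into one kernel-verified Lean document; each statement's English description precedes it below -/
import Mathlib

section
/- Let α = (α_1,…,α_k) be a composition of n and let P_α be the canonical hinge on ℂ^n. Then for any choices of the operators λ^j(P_α) (j = 1,…,n), there exists a nonzero constant c ∈ ℂ such that (⊗_{j=1}^n λ^j(P_α)^{⊗(ν_j−ν_{j+1})}) Ξ_ν = c·Ξ_ν. -/
open Module

noncomputable section

variable {V W Y Z : Type*}
  [AddCommGroup V] [Module ℂ V] [AddCommGroup W] [Module ℂ W]
  [AddCommGroup Y] [Module ℂ Y] [AddCommGroup Z] [Module ℂ Z]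

/-- The kernel of a linear relation `P : V ⇉ W`. -/
def relKer (P : Submodule ℂ (V × W)) : Submodule ℂ V :=
  P.comap (LinearMap.inl ℂ V W)

/-- The indefiniteness of a linear relation `P : V ⇉ W`. -/
def relIndef (P : Submodule ℂ (V × W)) : Submodule ℂ W :=
  P.comap (LinearMap.inr ℂ V W)

/-- The domain of a linear relation `P : V ⇉ W`. -/
def relDom (P : Submodule ℂ (V × W)) : Submodule ℂ V :=
  P.map (LinearMap.fst ℂ V W)

/-- The image of a linear relation `P : V ⇉ W`. -/
def relIm (P : Submodule ℂ (V × W)) : Submodule ℂ W :=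
  P.map (LinearMap.snd ℂ V W)

/-- The product `QP` of two linear relations. -/
def relComp (Q : Submodule ℂ (W × Y)) (P : Submodule ℂ (V × W)) : Submodule ℂ (V × Y) where
  carrier := {p | ∃ w : W, (p.1, w) ∈ P ∧ (w, p.2) ∈ Q}
  add_mem' := by
    rintro ⟨a, b⟩ ⟨c, d⟩ ⟨w₁, h₁, h₂⟩ ⟨w₂, h₃, h₄⟩
    exact ⟨w₁ + w₂, P.add_mem h₁ h₃, Q.add_mem h₂ h₄⟩
  zero_mem' := ⟨0, P.zero_mem, Q.zero_mem⟩
  smul_mem' := by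
    rintro c ⟨a, b⟩ ⟨w, h₁, h₂⟩
    exact ⟨c • w, P.smul_mem c h₁, Q.smul_mem c h₂⟩

/-- The pair `(Q, P)` of linear relations is transversal. -/
def Transversal (Q : Submodule ℂ (W × Y)) (P : Submodule ℂ (V × W)) : Prop :=
  relIm P ⊔ relDom Q = ⊤ ∧ relIndef P ⊓ relKer Q = ⊥

end

noncomputable section

variable {V W : Type*} [AddCommGroup V] [Module ℂ V] [AddCommGroup W] [Module ℂ W]

/-- A canonical basis pair for a linear relation `S : V ⇉ W`: a basis
`f₁,…,f_α, g₁,…,g_β, h₁,…,h_γ` of `V` and a basis `F₁,…,F_μ, G₁,…,G_β, H₁,…,H_ν` of `W`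
such that `S` is spanned by the vectors `(0,Fᵢ)`, `(gⱼ,Gⱼ)`, `(hₗ,0)`. -/
structure CanonicalBasisPair (S : Submodule ℂ (V × W)) where
  α : ℕ
  β : ℕ
  γ : ℕ
  μ : ℕ
  ν : ℕ
  bV : Basis (Fin α ⊕ Fin β ⊕ Fin γ) ℂ V
  bW : Basis (Fin μ ⊕ Fin β ⊕ Fin ν) ℂ W
  hspan : S = Submodule.span ℂ
      (Set.range (fun i : Fin μ => ((0 : V), bW (Sum.inl i))) ∪
       Set.range (fun j : Fin β => (bV (Sum.inr (Sum.inl j)), bW (Sum.inr (Sum.inl j)))) ∪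
       Set.range (fun l : Fin γ => (bV (Sum.inr (Sum.inr l)), (0 : W))))

end

noncomputable section

variable {V W : Type*} [AddCommGroup V] [Module ℂ V] [AddCommGroup W] [Module ℂ W]

/-- The tuple `f₁, …, f_α, g_{i₁}, …, g_{i_s}` (with `i₁ < … < i_s` the elements of `s`)
in `V`, associated with a canonical basis pair. -/
def goodTupleV {S : Submodule ℂ (V × W)} (c : CanonicalBasisPair S)
    (s : Finset (Fin c.β)) : Fin (c.α + s.card) → V :=
  Fin.addCases (fun i => c.bV (Sum.inl i))
    (fun j => c.bV (Sum.inr (Sum.inl ((s.orderIsoOfFin rfl j : s) : Fin c.β))))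

/-- The tuple `F₁, …, F_μ, G_{i₁}, …, G_{i_s}` (with `i₁ < … < i_s` the elements of `s`)
in `W`, associated with a canonical basis pair. -/
def goodTupleW {S : Submodule ℂ (V × W)} (c : CanonicalBasisPair S)
    (s : Finset (Fin c.β)) : Fin (c.μ + s.card) → W :=
  Fin.addCases (fun i => c.bW (Sum.inl i))
    (fun j => c.bW (Sum.inr (Sum.inl ((s.orderIsoOfFin rfl j : s) : Fin c.β))))

/-- `L : Λ(V) → Λ(W)` is the operator `λ(S)` obtained from the canonical basis pair `c` for `S`:
it sends each basis monomial `f₁∧…∧f_α∧g_{i₁}∧…∧g_{i_s}` to `F₁∧…∧F_μ∧G_{i₁}∧…∧G_{i_s}` and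
every other monomial in the chosen basis of `V` (i.e. every monomial of basis vectors that
misses some `f` or contains some `h`) to `0`. -/
def IsLambda {S : Submodule ℂ (V × W)} (c : CanonicalBasisPair S)
    (L : ExteriorAlgebra ℂ V →ₗ[ℂ] ExteriorAlgebra ℂ W) : Prop :=
  (∀ s : Finset (Fin c.β),
      L (ExteriorAlgebra.ιMulti ℂ _ (goodTupleV c s)) =
        ExteriorAlgebra.ιMulti ℂ _ (goodTupleW c s)) ∧
  (∀ (k : ℕ) (x : Fin k → (Fin c.α ⊕ Fin c.β ⊕ Fin c.γ)),
      ((∃ i : Fin c.α, Sum.inl i ∉ Set.range x) ∨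
        (∃ l : Fin c.γ, Sum.inr (Sum.inr l) ∈ Set.range x)) →
      L (ExteriorAlgebra.ιMulti ℂ k (fun i => c.bV (x i))) = 0)

end

noncomputable section

variable {V W : Type*} [AddCommGroup V] [Module ℂ V] [AddCommGroup W] [Module ℂ W]

/-- The wedge product `x₁ ∧ … ∧ x_m` as an element of the `m`-th exterior power. -/
def ιMultiP (m : ℕ) (x : Fin m → V) : ⋀[ℂ]^m V :=
  ⟨ExteriorAlgebra.ιMulti ℂ m x, ExteriorAlgebra.ιMulti_range ℂ m (Set.mem_range_self x)⟩

/-- `L : Λ^m V → Λ^m W` is the degree-`m` component `λ^m(S)` of the operator obtained from the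
canonical basis pair `c` for `S`: it sends each degree-`m` basis monomial
`f₁∧…∧f_α∧g_{i₁}∧…∧g_{i_s}` to `F₁∧…∧F_μ∧G_{i₁}∧…∧G_{i_s}` and every other degree-`m`
monomial in the chosen basis of `V` to `0`. -/
def IsLambdaM {S : Submodule ℂ (V × W)} (c : CanonicalBasisPair S) (m : ℕ)
    (L : (⋀[ℂ]^m V) →ₗ[ℂ] (⋀[ℂ]^m W)) : Prop :=
  (∀ (s : Finset (Fin c.β)) (h1 : c.α + s.card = m) (h2 : c.μ + s.card = m),
      L (ιMultiP m (goodTupleV c s ∘ Fin.cast h1.symm)) =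
        ιMultiP m (goodTupleW c s ∘ Fin.cast h2.symm)) ∧
  (∀ x : Fin m → (Fin c.α ⊕ Fin c.β ⊕ Fin c.γ),
      ((∃ i : Fin c.α, Sum.inl i ∉ Set.range x) ∨
        (∃ l : Fin c.γ, Sum.inr (Sum.inr l) ∈ Set.range x)) →
      L (ιMultiP m fun i => c.bV (x i)) = 0)

end

/-- `(P 0, …, P (k-1))` is a hinge on `V` (with `n = dim V`): each `P j` is a linear relation
`V ⇉ V` of dimension `n`, consecutive terms satisfy `Ker P_j = Dom P_{j+1}` and
`Im P_j = Indef P_{j+1}`, the first term satisfies `Dom P_1 = V`, the last term satisfies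
`Im P_k = V`, and every term has positive rank. -/
structure IsHinge {V : Type*} [AddCommGroup V] [Module ℂ V]
    {k : ℕ} (P : Fin k → Submodule ℂ (V × V)) : Prop where
  pos : 0 < k
  dim_eq : ∀ j, Module.finrank ℂ (P j) = Module.finrank ℂ V
  ker_eq_dom : ∀ (j : ℕ) (h : j + 1 < k), relKer (P ⟨j, by omega⟩) = relDom (P ⟨j + 1, h⟩)
  im_eq_indef : ∀ (j : ℕ) (h : j + 1 < k), relIm (P ⟨j, by omega⟩) = relIndef (P ⟨j + 1, h⟩)
  dom_first : relDom (P ⟨0, pos⟩) = ⊤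
  im_last : relIm (P ⟨k - 1, by omega⟩) = ⊤
  rk_pos : ∀ j, Module.finrank ℂ (relKer (P j)) + Module.finrank ℂ (relIndef (P j)) <
    Module.finrank ℂ (P j)

noncomputable section

open scoped TensorProduct

/-- The `j`-th exterior power of a linear map, as a map between exterior powers. -/
def exteriorPowerMap {V W : Type*} [AddCommGroup V] [Module ℂ V] [AddCommGroup W] [Module ℂ W]
    (j : ℕ) (f : V →ₗ[ℂ] W) : (⋀[ℂ]^j V) →ₗ[ℂ] (⋀[ℂ]^j W) :=
  LinearMap.restrict (ExteriorAlgebra.map f).toLinearMap (by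
    intro x hx
    have h : Submodule.map (ExteriorAlgebra.map f).toLinearMap (⋀[ℂ]^j V) ≤ ⋀[ℂ]^j W := by
      rw [Submodule.map_pow]
      refine pow_le_pow_left' ?_ j
      rintro y ⟨z, ⟨v, rfl⟩, rfl⟩
      exact ⟨f v, (ExteriorAlgebra.map_apply_ι f v).symm⟩
    exact h ⟨x, hx, rfl⟩)

variable (n : ℕ) (ν : ℕ → ℕ)

/-- The representation space `𝔉_ν = ⨂_{j=1}^{n} (Λ^j ℂⁿ)^{⊗(ν_j − ν_{j+1})}`. -/
abbrev FrakF : Type :=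
  ⨂[ℂ] d : Fin n, (⨂[ℂ]^(ν (d.1 + 1) - ν (d.1 + 2)) ↥(⋀[ℂ]^(d.1 + 1) (Fin n → ℂ)))

/-- The vector `ξ_j = e₁ ∧ … ∧ e_j ∈ Λ^j ℂⁿ` (here `j = d + 1`). -/
def xiVec (d : Fin n) : ⋀[ℂ]^(d.1 + 1) (Fin n → ℂ) :=
  ιMultiP (d.1 + 1) (fun i => Pi.basisFun ℂ (Fin n) (Fin.castLE d.isLt i))

/-- The highest weight vector `Ξ_ν = ⨂_j ξ_j^{⊗(ν_j − ν_{j+1})} ∈ 𝔉_ν`. -/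
def XiNu : FrakF n ν :=
  PiTensorProduct.tprod ℂ (fun d => PiTensorProduct.tprod ℂ (fun _ => xiVec n d))

/-- The operator `⨂_{j=1}^{n} L_j^{⊗(ν_j − ν_{j+1})}` on `𝔉_ν` built from a family of operators
`L_j : Λ^j ℂⁿ → Λ^j ℂⁿ`. -/
def bigTensorOp
    (L : ∀ d : Fin n, (⋀[ℂ]^(d.1 + 1) (Fin n → ℂ)) →ₗ[ℂ] (⋀[ℂ]^(d.1 + 1) (Fin n → ℂ))) :
    FrakF n ν →ₗ[ℂ] FrakF n ν :=
  PiTensorProduct.map (fun d => PiTensorProduct.map (fun _ => L d))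

/-- The representation `𝔯_ν(g) = ⨂_{j=1}^{n} (Λ^j g)^{⊗(ν_j − ν_{j+1})}` of `GL_n(ℂ)`. -/
def rNu (g : (Fin n → ℂ) ≃ₗ[ℂ] (Fin n → ℂ)) : FrakF n ν →ₗ[ℂ] FrakF n ν :=
  bigTensorOp n ν (fun d => exteriorPowerMap (d.1 + 1) (g : (Fin n → ℂ) →ₗ[ℂ] (Fin n → ℂ)))

/-- `H_ν ⊆ 𝔉_ν`, the span of the `GL_n(ℂ)`-orbit of `Ξ_ν`. -/
def HNu : Submodule ℂ (FrakF n ν) :=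
  Submodule.span ℂ (Set.range fun g : (Fin n → ℂ) ≃ₗ[ℂ] (Fin n → ℂ) => rNu n ν g (XiNu n ν))

/-- `L` is a choice of the operator `λ^m(P)` of a hinge `P = (P_1,…,P_k)`: a nonzero operator
obtained from a canonical basis pair of one of the terms `P_i`. -/
def IsLambdaChoice {V : Type*} [AddCommGroup V] [Module ℂ V]
    {k : ℕ} (P : Fin k → Submodule ℂ (V × V)) (m : ℕ)
    (L : (⋀[ℂ]^m V) →ₗ[ℂ] (⋀[ℂ]^m V)) : Prop :=
  ∃ (i : Fin k) (c : CanonicalBasisPair (P i)), IsLambdaM c m L ∧ L ≠ 0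

end

noncomputable section

/-- The linear relation on `ℂⁿ` spanned by the vectors `(0, e_σ)` for `σ < a`,
`(e_τ, e_τ)` for `a ≤ τ < b`, and `(e_μ, 0)` for `b ≤ μ`. -/
def canonicalRel (n a b : ℕ) : Submodule ℂ ((Fin n → ℂ) × (Fin n → ℂ)) :=
  Submodule.span ℂ
    {p | ∃ σ : Fin n,
        (σ.1 < a ∧ p = (0, Pi.basisFun ℂ (Fin n) σ)) ∨
        (a ≤ σ.1 ∧ σ.1 < b ∧ p = (Pi.basisFun ℂ (Fin n) σ, Pi.basisFun ℂ (Fin n) σ)) ∨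
        (b ≤ σ.1 ∧ p = (Pi.basisFun ℂ (Fin n) σ, 0))}

/-- The partial sum `u_j = α_1 + … + α_{j-1}` of a composition. -/
def partialSum {k : ℕ} (α : Fin k → ℕ) (j : ℕ) : ℕ :=
  ∑ i ∈ Finset.univ.filter (fun i : Fin k => i.1 < j), α i

/-- The canonical hinge `P_α` on `ℂⁿ` associated with a composition `α` of `n`. -/
def canonicalHinge (n : ℕ) {k : ℕ} (α : Fin k → ℕ) :
    Fin k → Submodule ℂ ((Fin n → ℂ) × (Fin n → ℂ)) :=
  fun j => canonicalRel n (partialSum α j.1) (partialSum α (j.1 + 1))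

end

noncomputable section

open ExteriorAlgebra

section Alternating

variable {M N : Type*} [AddCommGroup M] [Module ℂ M] [AddCommGroup N] [Module ℂ N]

/-- The value of an alternating map on vectors lying in the span of `u` is a multiple of its
value on `u`. -/
lemma AlternatingMap.exists_eq_smul_of_mem_span {k : ℕ} (A : M [⋀^Fin k]→ₗ[ℂ] N)
    (u v : Fin k → M) (h : ∀ i, v i ∈ Submodule.span ℂ (Set.range u)) :
    ∃ c : ℂ, A v = c • A u := by
  choose a ha using fun i => (Submodule.mem_span_range_iff_exists_fun ℂ).1 (h i)
  have key : A.compLinearMap (Fintype.linearCombination ℂ u) =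
      (LinearMap.toSpanSingleton ℂ N (A u)).compAlternatingMap
        (Pi.basisFun ℂ (Fin k)).det := by
    refine Basis.ext_alternating (Pi.basisFun ℂ (Fin k)) fun x hx => ?_
    obtain ⟨σ, rfl⟩ : ∃ σ : Equiv.Perm (Fin k), x = σ :=
      ⟨Equiv.ofBijective x (Finite.injective_iff_bijective.1 hx), rfl⟩
    have h1 : (fun i => Fintype.linearCombination ℂ u (Pi.basisFun ℂ (Fin k) (σ i))) = u ∘ σ := by
      funext i
      simp [Fintype.linearCombination_apply]
    have h2 : (Pi.basisFun ℂ (Fin k)).det (fun i => Pi.basisFun ℂ (Fin k) (σ i)) =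
        Equiv.Perm.sign σ • (1 : ℂ) := by
      rw [← (Pi.basisFun ℂ (Fin k)).det_self]
      exact AlternatingMap.map_perm _ _ σ
    rw [AlternatingMap.compLinearMap_apply, LinearMap.compAlternatingMap_apply, h2]
    refine (congrArg A h1).trans ?_
    rw [A.map_perm, LinearMap.toSpanSingleton_apply]
    simp [Units.smul_def, ← Int.cast_smul_eq_zsmul ℂ]
  refine ⟨(Pi.basisFun ℂ (Fin k)).det a, ?_⟩
  have h3 := congrArg (fun B => B a) key
  have h4 : (fun i => Fintype.linearCombination ℂ u (a i)) = v := by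
    funext i
    rw [Fintype.linearCombination_apply, ha]
  simp only [AlternatingMap.compLinearMap_apply, LinearMap.compAlternatingMap_apply,
    LinearMap.toSpanSingleton_apply] at h3
  rw [← h3]
  exact congrArg A h4.symm

lemma ιMulti_comp_cast {m k : ℕ} (h : m = k) (v : Fin k → M) :
    ιMulti ℂ m (v ∘ Fin.cast h) = ιMulti ℂ k v := by
  subst h
  rfl

/-- An injective tuple is a permutation of the increasing enumeration of its image. -/
lemma exists_perm_eq_orderEmbOfFin {r : ℕ} {ι : Type*} [LinearOrder ι] (y : Fin r → ι)
    (hy : Function.Injective y) :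
    ∃ (s : Finset ι) (hs : s.card = r) (σ : Equiv.Perm (Fin r)), y = s.orderEmbOfFin hs ∘ σ := by
  have hs : (Finset.univ.map ⟨y, hy⟩).card = r := by simp
  set s := Finset.univ.map ⟨y, hy⟩ with hsdef
  have hmem : ∀ i, y i ∈ s := fun i => by simp [hsdef]
  have hinj : Function.Injective fun i => (s.orderIsoOfFin hs).symm ⟨y i, hmem i⟩ := by
    intro i j hij
    simpa using hy (Subtype.ext_iff.1 ((s.orderIsoOfFin hs).symm.injective hij))
  refine ⟨s, hs, Equiv.ofBijective _ (Finite.injective_iff_bijective.1 hinj), ?_⟩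
  funext i
  simp [← Finset.coe_orderIsoOfFin_apply]

/-- A linear map from an exterior power extends to the whole exterior algebra. -/
lemma exists_extend_exteriorPower {m : ℕ} (L : (⋀[ℂ]^m M) →ₗ[ℂ] (⋀[ℂ]^m N)) :
    ∃ Λ : ExteriorAlgebra ℂ M →ₗ[ℂ] ExteriorAlgebra ℂ N,
      ∀ x, Λ (ιMulti ℂ m x) = L (ιMultiP m x) := by
  obtain ⟨Λ, hΛ⟩ := LinearMap.exists_extend ((⋀[ℂ]^m N).subtype ∘ₗ L)
  exact ⟨Λ, fun x => LinearMap.congr_fun hΛ (ιMultiP m x)⟩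

/-- Wedge monomials in a basis are nonzero. -/
lemma ιMulti_basis_ne_zero {ι : Type*} (b : Basis ι ℂ M) {m : ℕ} (x : Fin m → ι)
    (hx : Function.Injective x) : ιMulti ℂ m (fun i => b (x i)) ≠ 0 := by
  intro h0
  have h1 : exteriorPower.ιMulti ℂ m (fun i => b (x i)) = 0 := Subtype.ext h0
  have h2 := exteriorPower.alternatingMapLinearEquiv_apply_ιMulti
    ((Pi.basisFun ℂ (Fin m)).det.compLinearMap
      (LinearMap.pi fun i => b.coord (x i))) (fun i => b (x i))
  rw [h1, map_zero, AlternatingMap.compLinearMap_apply] at h2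
  have h3 : (fun j => LinearMap.pi (fun i => b.coord (x i)) (b (x j))) =
      Pi.basisFun ℂ (Fin m) := by
    funext j i
    classical
    simp [Finsupp.single_apply, Pi.single_apply, hx.eq_iff, eq_comm]
  have h4 : (Pi.basisFun ℂ (Fin m)).det (Pi.basisFun ℂ (Fin m)) = 0 := by
    rw [← h3]
    exact h2.symm
  rw [Basis.det_self] at h4
  exact one_ne_zero h4

end Alternating

namespace CanonicalBasisPair

variable {V W : Type*} [AddCommGroup V] [Module ℂ V] [AddCommGroup W] [Module ℂ W]
  {S : Submodule ℂ (V × W)} (c : CanonicalBasisPair S)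

/-- The projection of `V` onto the span of the `gⱼ` and `hₗ` that kills the `fᵢ`. -/
def domProj : V →ₗ[ℂ] V := c.bV.constr ℂ (Sum.elim 0 (c.bV ∘ Sum.inr))

/-- The projection of `W` onto the span of the `Gⱼ` and `Hₗ` that kills the `Fᵢ`. -/
def indefProj : W →ₗ[ℂ] W := c.bW.constr ℂ (Sum.elim 0 (c.bW ∘ Sum.inr))

/-- The linear map sending `gⱼ` to `Gⱼ` and killing the `fᵢ` and `hₗ`. -/
def coreMap : V →ₗ[ℂ] W := c.bV.constr ℂ (Sum.elim 0 (Sum.elim (c.bW ∘ Sum.inr ∘ Sum.inl) 0))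

/-- The linear map sending `Gⱼ` to `gⱼ` and killing the `Fᵢ` and `Hₗ`. -/
def coreInv : W →ₗ[ℂ] V := c.bW.constr ℂ (Sum.elim 0 (Sum.elim (c.bV ∘ Sum.inr ∘ Sum.inl) 0))

@[simp] lemma domProj_inl (i) : c.domProj (c.bV (Sum.inl i)) = 0 := by simp [domProj]
@[simp] lemma domProj_inr (i) : c.domProj (c.bV (Sum.inr i)) = c.bV (Sum.inr i) := by
  simp [domProj]
@[simp] lemma indefProj_inl (i) : c.indefProj (c.bW (Sum.inl i)) = 0 := by simp [indefProj]
@[simp] lemma indefProj_inr (i) : c.indefProj (c.bW (Sum.inr i)) = c.bW (Sum.inr i) := by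
  simp [indefProj]
@[simp] lemma coreMap_inl (i) : c.coreMap (c.bV (Sum.inl i)) = 0 := by simp [coreMap]
@[simp] lemma coreMap_inr_inl (j) :
    c.coreMap (c.bV (Sum.inr (Sum.inl j))) = c.bW (Sum.inr (Sum.inl j)) := by simp [coreMap]
@[simp] lemma coreMap_inr_inr (l) : c.coreMap (c.bV (Sum.inr (Sum.inr l))) = 0 := by
  simp [coreMap]
@[simp] lemma coreInv_inl (i) : c.coreInv (c.bW (Sum.inl i)) = 0 := by simp [coreInv]
@[simp] lemma coreInv_inr_inl (j) :
    c.coreInv (c.bW (Sum.inr (Sum.inl j))) = c.bV (Sum.inr (Sum.inl j)) := by simp [coreInv]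

lemma le_of_generators {T : Submodule ℂ (V × W)}
    (hF : ∀ i, ((0 : V), c.bW (Sum.inl i)) ∈ T)
    (hG : ∀ j, (c.bV (Sum.inr (Sum.inl j)), c.bW (Sum.inr (Sum.inl j))) ∈ T)
    (hH : ∀ l, (c.bV (Sum.inr (Sum.inr l)), (0 : W)) ∈ T) : S ≤ T := by
  rw [c.hspan, Submodule.span_le]
  rintro _ ((⟨i, rfl⟩ | ⟨j, rfl⟩) | ⟨l, rfl⟩)
  exacts [hF i, hG j, hH l]

lemma inl_mem (i) : ((0 : V), c.bW (Sum.inl i)) ∈ S := by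
  exact c.hspan.ge (Submodule.subset_span <| .inl (.inl ⟨i, rfl⟩))

lemma inr_inl_mem (j) : (c.bV (Sum.inr (Sum.inl j)), c.bW (Sum.inr (Sum.inl j))) ∈ S := by
  exact c.hspan.ge (Submodule.subset_span <| .inl (.inr ⟨j, rfl⟩))

lemma inr_inr_mem (l) : (c.bV (Sum.inr (Sum.inr l)), (0 : W)) ∈ S := by
  exact c.hspan.ge (Submodule.subset_span <| .inr ⟨l, rfl⟩)

variable {c}

lemma domProj_eq_of_mem {x : V} {y : W} (h : (x, y) ∈ S) : c.domProj x = x := by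
  have := c.le_of_generators
    (T := LinearMap.eqLocus (c.domProj ∘ₗ LinearMap.fst ℂ V W) (LinearMap.fst ℂ V W))
    (by simp) (by simp) (by simp) h
  simpa using this

lemma indefProj_eq_of_mem {x : V} {y : W} (h : (x, y) ∈ S) : c.indefProj y = c.coreMap x := by
  have := c.le_of_generators
    (T := LinearMap.eqLocus (c.indefProj ∘ₗ LinearMap.snd ℂ V W)
      (c.coreMap ∘ₗ LinearMap.fst ℂ V W))
    (by simp) (by simp) (by simp) h
  simpa using this

lemma sub_coreMap_mem {x : V} {y : W} (h : (x, y) ∈ S) :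
    y - c.coreMap x ∈ Submodule.span ℂ (Set.range fun i => c.bW (Sum.inl i)) :=
  c.le_of_generators
    (T := (Submodule.span ℂ (Set.range fun i => c.bW (Sum.inl i))).comap
      (LinearMap.snd ℂ V W - c.coreMap ∘ₗ LinearMap.fst ℂ V W))
    (fun i => by simpa using Submodule.subset_span (Set.mem_range_self i)) (by simp) (by simp) h

lemma sub_coreInv_mem {x : V} {y : W} (h : (x, y) ∈ S) :
    x - c.coreInv y ∈ Submodule.span ℂ (Set.range fun l => c.bV (Sum.inr (Sum.inr l))) :=
  c.le_of_generators
    (T := (Submodule.span ℂ (Set.range fun l => c.bV (Sum.inr (Sum.inr l)))).comap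
      (LinearMap.fst ℂ V W - c.coreInv ∘ₗ LinearMap.snd ℂ V W))
    (by simp) (by simp) (fun l => by simpa using Submodule.subset_span (Set.mem_range_self l)) h

lemma mem_span_of_zero_left_mem {y : W} (h : ((0 : V), y) ∈ S) :
    y ∈ Submodule.span ℂ (Set.range fun i => c.bW (Sum.inl i)) := by
  simpa using c.sub_coreMap_mem h

lemma mem_span_of_zero_right_mem {x : V} (h : (x, (0 : W)) ∈ S) :
    x ∈ Submodule.span ℂ (Set.range fun l => c.bV (Sum.inr (Sum.inr l))) := by
  simpa using c.sub_coreInv_mem h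

variable (c)

/-- The projection of `V` along its domain part is spanned by the images of the vectors `f'ᵢ` of
any other canonical basis pair. -/
lemma sub_domProj_mem_span (c' : CanonicalBasisPair S) (v : V) :
    v - c.domProj v ∈ Submodule.span ℂ
      (Set.range fun i => c'.bV (Sum.inl i) - c.domProj (c'.bV (Sum.inl i))) := by
  suffices h : (⊤ : Submodule ℂ V) ≤ (Submodule.span ℂ (Set.range fun i =>
      c'.bV (Sum.inl i) - c.domProj (c'.bV (Sum.inl i)))).comap (LinearMap.id - c.domProj) from
    h (Submodule.mem_top (x := v))
  rw [← c'.bV.span_eq, Submodule.span_le]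
  rintro _ ⟨i | j | l, rfl⟩
  · exact Submodule.subset_span ⟨i, rfl⟩
  · simp [c.domProj_eq_of_mem (c'.inr_inl_mem j)]
  · simp [c.domProj_eq_of_mem (c'.inr_inr_mem l)]

lemma inl_mem_span (c' : CanonicalBasisPair S) (i) :
    c.bV (Sum.inl i) ∈ Submodule.span ℂ
      (Set.range fun i => c'.bV (Sum.inl i) - c.domProj (c'.bV (Sum.inl i))) := by
  simpa using c.sub_domProj_mem_span c' (c.bV (Sum.inl i))

lemma card_le_of_mem_span {M : Type*} [AddCommGroup M] [Module ℂ M] {p q : ℕ} {v : Fin p → M}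
    {w : Fin q → M} (hv : LinearIndependent ℂ v)
    (h : ∀ i, v i ∈ Submodule.span ℂ (Set.range w)) : p ≤ q := by
  classical
  have h1 := linearIndependent_le_span_aux' v hv (Set.range w) (by rintro _ ⟨i, rfl⟩; exact h i)
  simpa using h1.trans (Fintype.card_range_le w)

lemma α_le (c' : CanonicalBasisPair S) : c.α ≤ c'.α :=
  card_le_of_mem_span (c.bV.linearIndependent.comp _ Sum.inl_injective) (c.inl_mem_span c')

lemma μ_le (c' : CanonicalBasisPair S) : c.μ ≤ c'.μ :=
  card_le_of_mem_span (c.bW.linearIndependent.comp _ Sum.inl_injective)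
    fun i => c'.mem_span_of_zero_left_mem (c.inl_mem i)

lemma γ_le (c' : CanonicalBasisPair S) : c.γ ≤ c'.γ :=
  card_le_of_mem_span (c.bV.linearIndependent.comp _ (Sum.inr_injective.comp Sum.inr_injective))
    fun i => c'.mem_span_of_zero_right_mem (c.inr_inr_mem i)

lemma finrank_eq : finrank ℂ V = c.α + (c.β + c.γ) := by
  simp [finrank_eq_card_basis c.bV]

end CanonicalBasisPair

lemma exists_ιMulti_eq_smul {M N : Type*} [AddCommGroup M] [Module ℂ M] [AddCommGroup N]
    [Module ℂ N] {p q : ℕ} (h : p = q) (φ : ExteriorAlgebra ℂ M →ₗ[ℂ] N) (u : Fin q → M)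
    (v : Fin p → M) (huv : ∀ i, v i ∈ Submodule.span ℂ (Set.range u)) :
    ∃ C : ℂ, φ (ιMulti ℂ p v) = C • φ (ιMulti ℂ q u) := by
  subst h
  exact (φ.compAlternatingMap (ιMulti ℂ p)).exists_eq_smul_of_mem_span u v huv

namespace CanonicalBasisPair

variable {V W : Type*} [AddCommGroup V] [Module ℂ V] [AddCommGroup W] [Module ℂ W]
  {S : Submodule ℂ (V × W)} {c : CanonicalBasisPair S}

lemma ιMulti_mul_indefProj {r : ℕ} (w : Fin r → W) :
    ιMulti ℂ c.μ (fun i => c.bW (Sum.inl i)) * ιMulti ℂ r (fun i => c.indefProj (w i)) =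
      ιMulti ℂ c.μ (fun i => c.bW (Sum.inl i)) * ιMulti ℂ r w := by
  have key : ((LinearMap.mulLeft ℂ (ιMulti ℂ c.μ fun i => c.bW (Sum.inl i))).compAlternatingMap
      (ιMulti ℂ r)).compLinearMap c.indefProj =
      (LinearMap.mulLeft ℂ (ιMulti ℂ c.μ fun i => c.bW (Sum.inl i))).compAlternatingMap
      (ιMulti ℂ r) := by
    refine Basis.ext_alternating c.bW fun x _ => ?_
    simp only [AlternatingMap.compLinearMap_apply, LinearMap.compAlternatingMap_apply,
      LinearMap.mulLeft_apply]
    by_cases hx : ∃ i a, x i = Sum.inl a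
    · obtain ⟨i, a, hi⟩ := hx
      rw [(ιMulti ℂ r).map_coord_zero i (by simp [hi]), mul_zero, ιMulti_mul_ιMulti]
      refine ((ιMulti ℂ _).map_eq_zero_of_eq _ (i := Fin.castAdd r a) (j := Fin.natAdd _ i)
        (by simp [hi]) ?_).symm
      simp only [ne_eq, Fin.ext_iff, Fin.val_castAdd, Fin.val_natAdd]
      omega
    · congr 2
      funext i
      rcases h : x i with a | b
      · exact (hx ⟨i, a, h⟩).elim
      · simp
  exact congrArg (fun B => B w) key

variable {r : ℕ} {L : (⋀[ℂ]^(c.α + r) V) →ₗ[ℂ] (⋀[ℂ]^(c.α + r) W)}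
  {Λ : ExteriorAlgebra ℂ V →ₗ[ℂ] ExteriorAlgebra ℂ W}

lemma apply_mul_of_injective (hL : IsLambdaM c (c.α + r) L)
    (hΛ : ∀ x, Λ (ιMulti ℂ (c.α + r) x) = L (ιMultiP (c.α + r) x)) (hμ : c.μ = c.α)
    (y : Fin r → Fin c.β) (hy : Function.Injective y) :
    Λ (ιMulti ℂ c.α (fun i => c.bV (Sum.inl i)) *
        ιMulti ℂ r (fun i => c.bV (Sum.inr (Sum.inl (y i))))) =
      ιMulti ℂ c.μ (fun i => c.bW (Sum.inl i)) *
        ιMulti ℂ r (fun i => c.bW (Sum.inr (Sum.inl (y i)))) := by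
  obtain ⟨s, hs, σ, rfl⟩ := exists_perm_eq_orderEmbOfFin y hy
  have e1 := (ιMulti ℂ r).map_perm
    (fun i => c.bV (Sum.inr (Sum.inl (s.orderEmbOfFin hs i)))) σ
  have e2 := (ιMulti ℂ r).map_perm
    (fun i => c.bW (Sum.inr (Sum.inl (s.orderEmbOfFin hs i)))) σ
  simp only [Function.comp_def] at e1 e2 ⊢
  rw [e1, e2, mul_smul_comm, mul_smul_comm, Units.smul_def, Units.smul_def, map_zsmul]
  congr 1
  subst hs
  have h := congrArg (Subtype.val) (hL.1 s rfl (by rw [hμ]))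
  rw [← hΛ, ιMulti_mul_ιMulti, ιMulti_mul_ιMulti] at *
  refine h.trans ?_
  exact ιMulti_comp_cast _ _

lemma apply_basis_mul_eq_zero (hL : IsLambdaM c (c.α + r) L)
    (hΛ : ∀ x, Λ (ιMulti ℂ (c.α + r) x) = L (ιMultiP (c.α + r) x))
    (x : Fin c.α → Fin c.α ⊕ Fin c.β ⊕ Fin c.γ) (y : Fin r → Fin c.α ⊕ Fin c.β ⊕ Fin c.γ)
    (h : (∃ i : Fin c.α, Sum.inl i ∉ Set.range (Fin.append x y)) ∨
        (∃ l : Fin c.γ, Sum.inr (Sum.inr l) ∈ Set.range (Fin.append x y))) :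
    Λ (ιMulti ℂ c.α (fun i => c.bV (x i)) * ιMulti ℂ r (fun i => c.bV (y i))) = 0 := by
  rw [ιMulti_mul_ιMulti]
  have h1 := congrArg Subtype.val (hL.2 _ h)
  rw [← hΛ, ZeroMemClass.coe_zero] at h1
  rw [← h1]
  congr 2
  funext i
  refine Fin.addCases (fun i => ?_) (fun i => ?_) i <;> simp

/-- The operator `λ(S)` on a wedge of all `fᵢ` with vectors from the domain of `S`. -/
lemma apply_mul_domProj (hL : IsLambdaM c (c.α + r) L)
    (hΛ : ∀ x, Λ (ιMulti ℂ (c.α + r) x) = L (ιMultiP (c.α + r) x)) (hμ : c.μ = c.α)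
    (w : Fin r → V) :
    Λ (ιMulti ℂ c.α (fun i => c.bV (Sum.inl i)) * ιMulti ℂ r (fun i => c.domProj (w i))) =
      ιMulti ℂ c.μ (fun i => c.bW (Sum.inl i)) * ιMulti ℂ r (fun i => c.coreMap (w i)) := by
  have key : ((Λ ∘ₗ LinearMap.mulLeft ℂ (ιMulti ℂ c.α fun i => c.bV (Sum.inl i))).compAlternatingMap
      (ιMulti ℂ r)).compLinearMap c.domProj =
      ((LinearMap.mulLeft ℂ (ιMulti ℂ c.μ fun i => c.bW (Sum.inl i))).compAlternatingMap
      (ιMulti ℂ r)).compLinearMap c.coreMap := by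
    refine Basis.ext_alternating c.bV fun x hx => ?_
    simp only [AlternatingMap.compLinearMap_apply, LinearMap.compAlternatingMap_apply,
      LinearMap.mulLeft_apply, LinearMap.comp_apply]
    by_cases hf : ∃ i a, x i = Sum.inl a
    · obtain ⟨i, a, hi⟩ := hf
      rw [(ιMulti ℂ r).map_coord_zero i (by simp [hi]), mul_zero, map_zero,
        (ιMulti ℂ r).map_coord_zero i (by simp [hi]), mul_zero]
    have hdom : ∀ i, c.domProj (c.bV (x i)) = c.bV (x i) := fun i => by
      rcases h : x i with a | b
      · exact (hf ⟨i, a, h⟩).elim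
      · simp
    simp only [hdom]
    by_cases hh : ∃ i l, x i = Sum.inr (Sum.inr l)
    · obtain ⟨i, l, hi⟩ := hh
      rw [(ιMulti ℂ r).map_coord_zero i (m := fun i => c.coreMap (c.bV (x i))) (by simp [hi]),
        mul_zero]
      exact apply_basis_mul_eq_zero hL hΛ Sum.inl x (.inr ⟨l, Fin.natAdd _ i, by simp [hi]⟩)
    have hg : ∀ i, ∃ j, x i = Sum.inr (Sum.inl j) := fun i => by
      rcases h : x i with a | b | l
      · exact (hf ⟨i, a, h⟩).elim
      · exact ⟨b, rfl⟩
      · exact (hh ⟨i, l, h⟩).elim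
    choose y hy using hg
    obtain rfl : x = fun i => Sum.inr (Sum.inl (y i)) := funext hy
    simpa using apply_mul_of_injective hL hΛ hμ y fun i j hij => hx (by simp [hij])
  exact congrArg (fun B => B w) key

lemma apply_basis_mul_domProj_eq_zero (hL : IsLambdaM c (c.α + r) L)
    (hΛ : ∀ x, Λ (ιMulti ℂ (c.α + r) x) = L (ιMultiP (c.α + r) x))
    (x : Fin c.α → Fin c.α ⊕ Fin c.β ⊕ Fin c.γ) (hx : ∃ i b, x i = Sum.inr b)
    (w : Fin r → V) :
    Λ (ιMulti ℂ c.α (fun i => c.bV (x i)) * ιMulti ℂ r (fun i => c.domProj (w i))) = 0 := by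
  have key : ((Λ ∘ₗ LinearMap.mulLeft ℂ (ιMulti ℂ c.α fun i => c.bV (x i))).compAlternatingMap
      (ιMulti ℂ r)).compLinearMap c.domProj = 0 := by
    refine Basis.ext_alternating c.bV fun y _ => ?_
    simp only [AlternatingMap.compLinearMap_apply, LinearMap.compAlternatingMap_apply,
      LinearMap.mulLeft_apply, LinearMap.comp_apply, AlternatingMap.zero_apply]
    by_cases hf : ∃ i a, y i = Sum.inl a
    · obtain ⟨i, a, hi⟩ := hf
      rw [(ιMulti ℂ r).map_coord_zero i (by simp [hi]), mul_zero, map_zero]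
    have hdom : ∀ i, c.domProj (c.bV (y i)) = c.bV (y i) := fun i => by
      rcases h : y i with a | b
      · exact (hf ⟨i, a, h⟩).elim
      · simp
    simp only [hdom]
    refine apply_basis_mul_eq_zero hL hΛ x y (.inl ?_)
    by_contra! hall
    have hex : ∀ a, ∃ i, x i = Sum.inl a := fun a => by
      obtain ⟨i, hi⟩ := hall a
      induction i using Fin.addCases with
      | left i => exact ⟨i, by simpa using hi⟩
      | right i => exact (hf ⟨i, a, by simpa using hi⟩).elim
    choose t ht using hex
    have htinj : Function.Injective t := fun a b hab =>
      Sum.inl_injective (by rw [← ht a, ← ht b, hab])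
    obtain ⟨i, b, hb⟩ := hx
    obtain ⟨a, rfl⟩ := Finite.surjective_of_injective htinj i
    simp [ht] at hb
  exact congrArg (fun B => B w) key

/-- On a wedge with vectors from the domain of `S`, the operator `λ(S)` depends on the other
factors only modulo the domain. -/
lemma apply_mul_domProj_eq_sub (hL : IsLambdaM c (c.α + r) L)
    (hΛ : ∀ x, Λ (ιMulti ℂ (c.α + r) x) = L (ιMultiP (c.α + r) x)) {p : ℕ} (hp : p = c.α)
    (v : Fin p → V) (w : Fin r → V) :
    Λ (ιMulti ℂ p (fun i => v i - c.domProj (v i)) * ιMulti ℂ r (fun i => c.domProj (w i))) =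
      Λ (ιMulti ℂ p v * ιMulti ℂ r (fun i => c.domProj (w i))) := by
  subst hp
  set A := (Λ ∘ₗ LinearMap.mulRight ℂ (ιMulti ℂ r fun i => c.domProj (w i))).compAlternatingMap
      (ιMulti ℂ c.α) with hA
  have key : A.compLinearMap (LinearMap.id - c.domProj) = A := by
    refine Basis.ext_alternating c.bV fun x _ => ?_
    simp only [hA, AlternatingMap.compLinearMap_apply, LinearMap.compAlternatingMap_apply,
      LinearMap.mulRight_apply, LinearMap.comp_apply, LinearMap.sub_apply, LinearMap.id_apply]
    by_cases hx : ∃ i b, x i = Sum.inr b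
    · rw [apply_basis_mul_domProj_eq_zero hL hΛ x hx w]
      obtain ⟨i, b, hi⟩ := hx
      rw [(ιMulti ℂ c.α).map_coord_zero i (by simp [hi]), zero_mul, map_zero]
    · congr 3
      funext i
      rcases h : x i with a | b
      · simp
      · exact (hx ⟨i, b, h⟩).elim
  exact congrArg (fun B => B v) key

/-- The operator `λ(S)` built from one canonical basis pair acts on the monomials of another one
as prescribed by the latter, up to a scalar. -/
lemma exists_eq_smul_apply (c' : CanonicalBasisPair S) (hL : IsLambdaM c (c.α + r) L)
    (hΛ : ∀ x, Λ (ιMulti ℂ (c.α + r) x) = L (ιMultiP (c.α + r) x)) (hμ : c.μ = c.α)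
    (y : Fin r → Fin c'.β) :
    ∃ C : ℂ, ιMulti ℂ c'.μ (fun i => c'.bW (Sum.inl i)) *
        ιMulti ℂ r (fun i => c'.bW (Sum.inr (Sum.inl (y i)))) =
      C • Λ (ιMulti ℂ c'.α (fun i => c'.bV (Sum.inl i)) *
        ιMulti ℂ r (fun i => c'.bV (Sum.inr (Sum.inl (y i))))) := by
  have hdom : ∀ i, c.domProj (c'.bV (Sum.inr (Sum.inl (y i)))) = c'.bV (Sum.inr (Sum.inl (y i))) :=
    fun i => c.domProj_eq_of_mem (c'.inr_inl_mem _)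
  obtain ⟨C₁, h₁⟩ := exists_ιMulti_eq_smul ((c'.μ_le c).antisymm (c.μ_le c'))
    (LinearMap.mulRight ℂ (ιMulti ℂ r fun i => c'.bW (Sum.inr (Sum.inl (y i)))))
    (fun i => c.bW (Sum.inl i)) (fun i => c'.bW (Sum.inl i))
    fun i => c.mem_span_of_zero_left_mem (c'.inl_mem i)
  obtain ⟨C₂, h₂⟩ := exists_ιMulti_eq_smul ((c.α_le c').antisymm (c'.α_le c))
    (Λ ∘ₗ LinearMap.mulRight ℂ
      (ιMulti ℂ r fun i => c.domProj (c'.bV (Sum.inr (Sum.inl (y i))))))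
    (fun i => c'.bV (Sum.inl i) - c.domProj (c'.bV (Sum.inl i))) (fun i => c.bV (Sum.inl i))
    (c.inl_mem_span c')
  have h₃ := apply_mul_domProj hL hΛ hμ fun i => c'.bV (Sum.inr (Sum.inl (y i)))
  have h₄ := apply_mul_domProj_eq_sub hL hΛ ((c'.α_le c).antisymm (c.α_le c'))
    (fun i => c'.bV (Sum.inl i)) fun i => c'.bV (Sum.inr (Sum.inl (y i)))
  simp only [← fun i => c.indefProj_eq_of_mem (c'.inr_inl_mem i), ιMulti_mul_indefProj] at h₃
  simp only [LinearMap.comp_apply, LinearMap.mulRight_apply] at h₁ h₂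
  rw [h₄] at h₂
  simp only [hdom] at h₂ h₃
  exact ⟨C₁ * C₂, by rw [h₁, ← h₃, h₂, smul_smul]⟩

/-- If `λᵐ(S)` is nonzero, then `α ≤ m ≤ α + β`. -/
lemma le_and_le_of_ne_zero {m : ℕ} {L : (⋀[ℂ]^m V) →ₗ[ℂ] (⋀[ℂ]^m W)} (hL : IsLambdaM c m L)
    (h0 : L ≠ 0) : c.α ≤ m ∧ m ≤ c.α + c.β := by
  by_contra hm
  refine h0 (exteriorPower.linearMap_ext ?_)
  refine Basis.ext_alternating c.bV fun x hx => ?_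
  simp only [LinearMap.compAlternatingMap_apply, LinearMap.zero_apply]
  refine hL.2 x ?_
  by_contra! hx'
  obtain ⟨h1, h2⟩ := hx'
  apply hm
  constructor
  · choose t ht using h1
    have := Fintype.card_le_of_injective t fun a b hab =>
      Sum.inl_injective (by rw [← ht a, ← ht b, hab])
    simpa using this
  · have hy : ∀ i, ∃ z : Fin c.α ⊕ Fin c.β, x i = Sum.map id Sum.inl z := fun i => by
      rcases h : x i with a | b | l
      · exact ⟨Sum.inl a, rfl⟩
      · exact ⟨Sum.inr b, rfl⟩
      · exact (h2 l ⟨i, h⟩).elim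
    choose z hz using hy
    have := Fintype.card_le_of_injective z fun a b hab => hx (by rw [hz, hz, hab])
    simpa using this

end CanonicalBasisPair

section CanonicalRel

/-- The splitting of the coordinates into three consecutive blocks. -/
def blockEquiv (a p q : ℕ) : Fin a ⊕ Fin p ⊕ Fin q ≃ Fin (a + (p + q)) :=
  (Equiv.sumCongr (Equiv.refl _) finSumFinEquiv).trans finSumFinEquiv

@[simp] lemma blockEquiv_inl (a p q : ℕ) (i : Fin a) :
    (blockEquiv a p q (Sum.inl i)).1 = i.1 := by simp [blockEquiv]

@[simp] lemma blockEquiv_inr_inl (a p q : ℕ) (i : Fin p) :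
    (blockEquiv a p q (Sum.inr (Sum.inl i))).1 = a + i.1 := by simp [blockEquiv]

@[simp] lemma blockEquiv_inr_inr (a p q : ℕ) (i : Fin q) :
    (blockEquiv a p q (Sum.inr (Sum.inr i))).1 = a + (p + i.1) := by simp [blockEquiv]

/-- The canonical basis pair of a canonical relation given by the standard basis. -/
def canonicalRelBasisPair (a p q : ℕ) :
    CanonicalBasisPair (canonicalRel (a + (p + q)) a (a + p)) where
  α := a
  β := p
  γ := q
  μ := a
  ν := q
  bV := (Pi.basisFun ℂ _).reindex (blockEquiv a p q).symm
  bW := (Pi.basisFun ℂ _).reindex (blockEquiv a p q).symm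
  hspan := by
    unfold canonicalRel
    congr 1
    ext x
    simp only [Set.mem_ofPred_eq, Set.mem_union, Set.mem_range, Basis.reindex_apply,
      Equiv.symm_symm]
    rw [← (blockEquiv a p q).exists_congr_right]
    constructor
    · rintro ⟨i | j | l, h | h | h⟩ <;> simp at h <;> try omega
      · exact .inl (.inl ⟨i, by simp [h]⟩)
      · exact .inl (.inr ⟨j, by simp [h]⟩)
      · exact .inr ⟨l, by simp [h]⟩
    · rintro ((⟨i, rfl⟩ | ⟨j, rfl⟩) | ⟨l, rfl⟩)
      · exact ⟨Sum.inl i, .inl (by simp)⟩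
      · exact ⟨Sum.inr (Sum.inl j), .inr (.inl (by simp))⟩
      · exact ⟨Sum.inr (Sum.inr l), .inr (.inr (by simp))⟩

lemma ιMulti_initial_eq_mul {a p q r m : ℕ} (hr : r ≤ p) (h : m = a + r)
    (hm : m ≤ a + (p + q)) :
    ιMulti ℂ m (fun i => Pi.basisFun ℂ (Fin (a + (p + q))) (Fin.castLE hm i)) =
      ιMulti ℂ a (fun i => (canonicalRelBasisPair a p q).bV (Sum.inl i)) *
        ιMulti ℂ r (fun i => (canonicalRelBasisPair a p q).bV
          (Sum.inr (Sum.inl (Fin.castLE hr i)))) := by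
  subst h
  rw [ιMulti_mul_ιMulti]
  congr 1
  funext i
  induction i using Fin.addCases with
  | left i =>
    rw [Fin.append_left]
    refine Eq.trans ?_
      (Basis.reindex_apply (Pi.basisFun ℂ _) (blockEquiv a p q).symm _).symm
    exact congrArg (Pi.basisFun ℂ _) (Fin.ext (blockEquiv_inl a p q i).symm)
  | right i =>
    rw [Fin.append_right]
    refine Eq.trans ?_
      (Basis.reindex_apply (Pi.basisFun ℂ _) (blockEquiv a p q).symm _).symm
    exact congrArg (Pi.basisFun ℂ _)
      (Fin.ext (blockEquiv_inr_inl a p q (Fin.castLE hr i)).symm)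

/-- A nonzero `λᵐ` of a canonical relation has `e₁ ∧ … ∧ e_m` as an eigenvector with nonzero
eigenvalue. -/
lemma IsLambdaM.exists_apply_initial_eq_smul {n a b m : ℕ} (hab : a ≤ b) (hbn : b ≤ n)
    (hm : m ≤ n) {c : CanonicalBasisPair (canonicalRel n a b)}
    {L : (⋀[ℂ]^m (Fin n → ℂ)) →ₗ[ℂ] (⋀[ℂ]^m (Fin n → ℂ))}
    (hL : IsLambdaM c m L) (h0 : L ≠ 0) :
    ∃ C : ℂ, C ≠ 0 ∧ L (ιMultiP m fun i => Pi.basisFun ℂ (Fin n) (Fin.castLE hm i)) =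
      C • ιMultiP m fun i => Pi.basisFun ℂ (Fin n) (Fin.castLE hm i) := by
  obtain ⟨p, rfl⟩ := Nat.exists_eq_add_of_le hab
  obtain ⟨q, rfl⟩ : ∃ q, n = a + (p + q) := ⟨n - (a + p), by omega⟩
  have hα : c.α = a :=
    (c.α_le (canonicalRelBasisPair a p q)).antisymm ((canonicalRelBasisPair a p q).α_le c)
  have hμ : c.μ = a :=
    (c.μ_le (canonicalRelBasisPair a p q)).antisymm ((canonicalRelBasisPair a p q).μ_le c)
  have hγ : c.γ = q :=
    (c.γ_le (canonicalRelBasisPair a p q)).antisymm ((canonicalRelBasisPair a p q).γ_le c)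
  have hβ : c.β = p := by
    have := c.finrank_eq
    rw [finrank_fin_fun] at this
    omega
  obtain ⟨h1, h2⟩ := CanonicalBasisPair.le_and_le_of_ne_zero hL h0
  obtain ⟨r, rfl⟩ := Nat.exists_eq_add_of_le h1
  have hr : r ≤ p := by omega
  obtain ⟨Λ, hΛ⟩ := exists_extend_exteriorPower L
  obtain ⟨C, hC⟩ := CanonicalBasisPair.exists_eq_smul_apply (canonicalRelBasisPair a p q) hL hΛ
    (hμ.trans hα.symm) (Fin.castLE hr)
  have hξ := ιMulti_initial_eq_mul hr (congrArg (· + r) hα) hm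
  have hC' : ιMulti ℂ (c.α + r)
      (fun i => Pi.basisFun ℂ (Fin (a + (p + q))) (Fin.castLE hm i)) =
      C • Λ (ιMulti ℂ (c.α + r)
        (fun i => Pi.basisFun ℂ (Fin (a + (p + q))) (Fin.castLE hm i))) := by
    rw [hξ]
    exact hC
  have hC0 : C ≠ 0 := by
    rintro rfl
    rw [zero_smul] at hC'
    exact ιMulti_basis_ne_zero _ _ (Fin.castLE_injective hm) hC'
  refine ⟨C⁻¹, inv_ne_zero hC0, Subtype.ext ?_⟩
  rw [← hΛ, eq_comm]
  refine (congrArg (C⁻¹ • ·) hC').trans ?_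
  exact inv_smul_smul₀ hC0 _

lemma partialSum_mono {k : ℕ} (α : Fin k → ℕ) : Monotone (partialSum α) := fun i j hij =>
  Finset.sum_le_sum_of_subset fun x hx => by
    simp only [Finset.mem_filter_univ] at hx ⊢
    omega

lemma partialSum_le_sum {k : ℕ} (α : Fin k → ℕ) (j : ℕ) : partialSum α j ≤ ∑ i, α i :=
  Finset.sum_le_sum_of_subset (Finset.filter_subset _ _)

end CanonicalRel

/-- A tensor product of operators having the factors of `Ξ_ν` as eigenvectors has `Ξ_ν` as an
eigenvector. -/
lemma bigTensorOp_XiNu (n : ℕ) (ν : ℕ → ℕ)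
    (L : ∀ d : Fin n, (⋀[ℂ]^(d.1 + 1) (Fin n → ℂ)) →ₗ[ℂ] (⋀[ℂ]^(d.1 + 1) (Fin n → ℂ)))
    (C : Fin n → ℂ) (h : ∀ d, L d (xiVec n d) = C d • xiVec n d) :
    bigTensorOp n ν L (XiNu n ν) =
      (∏ d, C d ^ (ν (d.1 + 1) - ν (d.1 + 2))) • XiNu n ν := by
  simp only [bigTensorOp, XiNu, PiTensorProduct.map_tprod, h]
  rw [← MultilinearMap.map_smul_univ]
  congr 1
  funext d
  rw [MultilinearMap.map_smul_univ]
  simp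

end

theorem canonicalHinge_operator_fixes_XiNu
    (n : ℕ) (ν : ℕ → ℕ) (hν : ∀ i, ν (i + 1) ≤ ν i) (hν' : ν (n + 1) = 0)
    {k : ℕ} (α : Fin k → ℕ) (hα : ∀ j, 0 < α j) (hsum : ∑ j, α j = n)
    (L : ∀ d : Fin n, (⋀[ℂ]^(d.1 + 1) (Fin n → ℂ)) →ₗ[ℂ] (⋀[ℂ]^(d.1 + 1) (Fin n → ℂ)))
    (hL : ∀ d : Fin n, IsLambdaChoice (canonicalHinge n α) (d.1 + 1) (L d)) :
    ∃ c : ℂ, c ≠ 0 ∧ bigTensorOp n ν L (XiNu n ν) = c • XiNu n ν := by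
  choose i c hLc hL0 using hL
  choose C hC0 hC using fun d => (hLc d).exists_apply_initial_eq_smul
    (partialSum_mono α (Nat.le_succ _)) ((partialSum_le_sum α _).trans hsum.le) d.isLt (hL0 d)
  exact ⟨_, Finset.prod_ne_zero_iff.2 fun d _ => pow_ne_zero _ (hC0 d),
    bigTensorOp_XiNu n ν L C hC⟩
end

section
/- Let P be any hinge on ℂ^n and let λ^j(P) (j = 1,…,n) be choices of the nonzero operators associated with P. Then the restriction of the operator ⊗_{j=1}^n λ^j(P)^{⊗(ν_j−ν_{j+1})} to the invariant subspace H_ν ⊆ 𝔉_ν is a nonzero operator. -/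
open Module

/-- A pure tensor of nonzero vectors is nonzero. -/
theorem tprod_ne_zero_of_forall_ne_zero {ι K : Type*} [Fintype ι] [Field K] {M : ι → Type*}
    [∀ i, AddCommGroup (M i)] [∀ i, Module K (M i)] (x : ∀ i, M i) (hx : ∀ i, x i ≠ 0) :
    PiTensorProduct.tprod K x ≠ 0 := by
  choose φ hφ using fun i => Module.Projective.exists_dual_ne_zero K (hx i)
  intro h
  have h' := congrArg
    (PiTensorProduct.lift ((MultilinearMap.mkPiAlgebra K ι K).compLinearMap φ)) h
  rw [PiTensorProduct.lift.tprod, map_zero, MultilinearMap.compLinearMap_apply,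
    MultilinearMap.mkPiAlgebra_apply] at h'
  exact Finset.prod_ne_zero_iff.mpr (fun i _ => hφ i) h'

/-- A multilinear form evaluated on rows of a matrix is a polynomial in its entries. -/
theorem exists_mvPolynomial_eval_eq_multilinearMap {K κ ι σ : Type*} [Field K] [Fintype κ]
    [Fintype ι] [DecidableEq κ] (e : κ → σ) (f : MultilinearMap K (fun _ : κ => ι → K) K) :
    ∃ p : MvPolynomial (σ × ι) K,
      ∀ M : σ → ι → K, MvPolynomial.eval (fun q => M q.1 q.2) p = f (fun i => M (e i)) := by
  classical
  refine ⟨∑ r : κ → ι, MvPolynomial.C (f fun i => Pi.single (r i) 1) *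
    ∏ i, MvPolynomial.X (e i, r i), fun M => ?_⟩
  have h : (fun i => M (e i)) = fun i => ∑ j, M (e i) j • (Pi.single j 1 : ι → K) := by
    funext i
    exact pi_eq_sum_univ' (M (e i))
  rw [h, f.map_sum]
  simp [MultilinearMap.map_smul_univ, mul_comm]

/-- A nonzero linear map on an exterior power is nonzero on some decomposable vector. -/
theorem exists_apply_ιMultiP_ne_zero {V W : Type*} [AddCommGroup V] [Module ℂ V]
    [AddCommGroup W] [Module ℂ W] {m : ℕ} (L : (⋀[ℂ]^m V) →ₗ[ℂ] W) (hL : L ≠ 0) :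
    ∃ x : Fin m → V, L (ιMultiP m x) ≠ 0 := by
  by_contra! h
  exact hL (exteriorPower.linearMap_ext (AlternatingMap.ext h))

/-- Nonzero operators on the exterior powers of `ℂⁿ` are simultaneously nonzero on the images
of the vectors `ξ_j` under a suitable invertible transformation. -/
theorem exists_linearEquiv_forall_apply_xiVec_ne_zero (n : ℕ)
    (L : ∀ d : Fin n, (⋀[ℂ]^(d.1 + 1) (Fin n → ℂ)) →ₗ[ℂ] (⋀[ℂ]^(d.1 + 1) (Fin n → ℂ)))
    (hL : ∀ d, L d ≠ 0) :
    ∃ g : (Fin n → ℂ) ≃ₗ[ℂ] (Fin n → ℂ), ∀ d : Fin n,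
      L d (exteriorPowerMap (d.1 + 1) (g : (Fin n → ℂ) →ₗ[ℂ] (Fin n → ℂ)) (xiVec n d)) ≠ 0 := by
  choose x hx using fun d => exists_apply_ιMultiP_ne_zero (L d) (hL d)
  choose φ hφ using fun d => Module.Projective.exists_dual_ne_zero ℂ (hx d)
  choose p hp using fun d : Fin n =>
    exists_mvPolynomial_eval_eq_multilinearMap (Fin.castLE d.isLt)
      ((φ d ∘ₗ L d).compMultilinearMap
        (exteriorPower.ιMulti ℂ (d.1 + 1) (M := Fin n → ℂ)).toMultilinearMap)
  have hp0 : ∀ d, p d ≠ 0 := by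
    intro d h0
    have h := hp d (fun i => if hi : i.1 < d.1 + 1 then x d ⟨i, hi⟩ else 0)
    rw [h0, map_zero] at h
    refine hφ d (Eq.trans ?_ h.symm)
    change φ d (L d (ιMultiP _ _)) = φ d (L d (ιMultiP _ _))
    congr 3
    funext i
    have hi : (Fin.castLE (Nat.succ_le_of_lt d.isLt) i).1 < d.1 + 1 := i.isLt
    rw [dif_pos hi]
    rfl
  have hprod : (∏ d, p d) * (Matrix.mvPolynomialX (Fin n) (Fin n) ℂ).det ≠ 0 :=
    mul_ne_zero (Finset.prod_ne_zero_iff.mpr fun d _ => hp0 d)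
      (Matrix.det_mvPolynomialX_ne_zero (Fin n) ℂ)
  obtain ⟨a, ha⟩ : ∃ a : Fin n × Fin n → ℂ, MvPolynomial.eval a
      ((∏ d, p d) * (Matrix.mvPolynomialX (Fin n) (Fin n) ℂ).det) ≠ 0 := by
    by_contra! h
    exact hprod (MvPolynomial.funext fun a => by rw [h a, map_zero])
  rw [map_mul, map_prod] at ha
  let A : Matrix (Fin n) (Fin n) ℂ := Matrix.of fun i j => a (i, j)
  have hdet : A.det ≠ 0 := by
    have h := right_ne_zero_of_mul ha
    rw [RingHom.map_det] at h
    convert h using 2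
    ext i j
    simp [A]
  have hdetT : IsUnit A.transpose.det := by
    rw [Matrix.det_transpose]
    exact hdet.isUnit
  let g := Matrix.toLinearEquiv' A.transpose (Matrix.invertibleOfIsUnitDet _ hdetT)
  refine ⟨g, fun d h => Finset.prod_ne_zero_iff.mp (left_ne_zero_of_mul ha) d
    (Finset.mem_univ d) ((hp d A).trans ?_)⟩
  have hg : exteriorPowerMap (d.1 + 1) (g : (Fin n → ℂ) →ₗ[ℂ] (Fin n → ℂ)) (xiVec n d) =
      ιMultiP (d.1 + 1) fun i => A (Fin.castLE d.isLt i) := by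
    apply Subtype.ext
    refine (ExteriorAlgebra.map_apply_ιMulti _ _).trans ?_
    change _ = ExteriorAlgebra.ιMulti ℂ (d.1 + 1) _
    congr 1
    funext i j
    simp [g, Matrix.toLinearEquiv']
  change φ d (L d (ιMultiP _ _)) = 0
  rw [← hg, h, map_zero]

set_option synthInstance.maxHeartbeats 1000000 in
theorem hinge_operator_restriction_to_HNu_ne_zero
    (n : ℕ) (ν : ℕ → ℕ) (hν : ∀ i, ν (i + 1) ≤ ν i) (hν' : ν (n + 1) = 0)
    {k : ℕ} (P : Fin k → Submodule ℂ ((Fin n → ℂ) × (Fin n → ℂ))) (hP : IsHinge P)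
    (L : ∀ d : Fin n, (⋀[ℂ]^(d.1 + 1) (Fin n → ℂ)) →ₗ[ℂ] (⋀[ℂ]^(d.1 + 1) (Fin n → ℂ)))
    (hL : ∀ d : Fin n, IsLambdaChoice P (d.1 + 1) (L d)) :
    ∃ x ∈ HNu n ν, bigTensorOp n ν L x ≠ 0 := by
  choose _ _ _ hL0 using hL
  obtain ⟨g, hg⟩ := exists_linearEquiv_forall_apply_xiVec_ne_zero n L hL0
  refine ⟨rNu n ν g (XiNu n ν), Submodule.subset_span ⟨g, rfl⟩, ?_⟩
  simp only [rNu, XiNu, bigTensorOp, PiTensorProduct.map_tprod]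
  exact tprod_ne_zero_of_forall_ne_zero _ fun d =>
    tprod_ne_zero_of_forall_ne_zero _ fun _ => hg d
end

section
/- Every meromorphic family γ can be written in the form γ(z) = a(z)·diag(z^{−m_1},…,z^{−m_n})·b(z) on some punctured neighborhood of 0, where a and b are holomorphic maps from a neighborhood of 0 to the n×n complex matrices with a(0) and b(0) invertible, and m_1 ≥ m_2 ≥ … ≥ m_n are integers. Moreover, the integers m_1,…,m_n are uniquely determined by γ. -/
noncomputable section

open scoped Topology

/-- `γ` is a meromorphic family: a matrix-valued function whose entries are holomorphic on a
punctured neighborhood of `0` and meromorphic at `0`, and whose values are invertible for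
`z ≠ 0` near `0`. -/
def IsMeromorphicFamily (n : ℕ) (γ : ℂ → Matrix (Fin n) (Fin n) ℂ) : Prop :=
  (∀ i j, MeromorphicAt (fun z => γ z i j) 0) ∧
    ∀ᶠ z in 𝓝[≠] (0 : ℂ), IsUnit (γ z)

/-- `m₁ ≥ … ≥ m_n` are exponents for `γ`, i.e. `γ(z) = a(z)·diag(z^{-m₁},…,z^{-m_n})·b(z)`
near `0` with `a, b` holomorphic at `0` and `a(0), b(0)` invertible. -/
def IsExponents (n : ℕ) (γ : ℂ → Matrix (Fin n) (Fin n) ℂ) (m : Fin n → ℤ) : Prop :=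
  Antitone m ∧
  ∃ a b : ℂ → Matrix (Fin n) (Fin n) ℂ,
    (∀ i j, AnalyticAt ℂ (fun z => a z i j) 0) ∧
    (∀ i j, AnalyticAt ℂ (fun z => b z i j) 0) ∧
    IsUnit (a 0) ∧ IsUnit (b 0) ∧
    ∀ᶠ z in 𝓝[≠] (0 : ℂ),
      γ z = a z * Matrix.diagonal (fun i => z ^ (-(m i))) * b z

end

open Filter Matrix
open scoped Topology

/-- A square matrix with a zero block of rows `≥ k` and columns `≤ k` is singular. -/
theorem Matrix.det_eq_zero_of_zero_block {R : Type*} [CommRing R] {n : ℕ}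
    (A : Matrix (Fin n) (Fin n) R) (k : Fin n) (h : ∀ i j, k ≤ i → j ≤ k → A i j = 0) :
    A.det = 0 := by
  rw [Matrix.det_apply]
  refine Finset.sum_eq_zero fun σ _ => ?_
  obtain ⟨j, hj, hσ⟩ : ∃ j ≤ k, k ≤ σ j := by
    by_contra! hlt
    have hcard := Finset.card_le_card_of_injOn (s := Finset.Iic k) (t := Finset.Iio k) σ
      (fun j hj => by simpa using hlt j (by simpa using hj)) σ.injective.injOn
    simp at hcard
  have hprod : ∏ i, A (σ i) i = 0 := Finset.prod_eq_zero (Finset.mem_univ j) (h _ _ hσ hj)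
  rw [hprod, smul_zero]

/-- Exponents of two factorizations of the same family are comparable. -/
theorem IsExponents.le {n : ℕ} {γ : ℂ → Matrix (Fin n) (Fin n) ℂ} {m m' : Fin n → ℤ}
    (h : IsExponents n γ m) (h' : IsExponents n γ m') : m ≤ m' := by
  obtain ⟨hm, a, b, ha, hb, ua, ub, hγ⟩ := h
  obtain ⟨hm', a', b', ha', hb', ua', ub', hγ'⟩ := h'
  intro k
  by_contra! hk
  have toCont {c : ℂ → Matrix (Fin n) (Fin n) ℂ} (hc : ∀ i j, AnalyticAt ℂ (fun z => c z i j) 0) :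
      ContinuousAt c 0 :=
    continuousAt_pi.2 fun i => continuousAt_pi.2 fun j => (hc i j).continuousAt
  have cont {c d e : ℂ → Matrix (Fin n) (Fin n) ℂ} (hc : ContinuousAt c 0)
      (hd : ContinuousAt d 0) (he : ContinuousAt e 0) (i j : Fin n) :
      ContinuousAt (fun z => ((c z).det • (d z * e z)) i j) 0 := by
    have : Continuous fun p : Matrix (Fin n) (Fin n) ℂ × Matrix (Fin n) (Fin n) ℂ ×
        Matrix (Fin n) (Fin n) ℂ => (p.1.det • (p.2.1 * p.2.2)) i j :=
      ((continuous_fst.matrix_det).smul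
        ((continuous_fst.comp continuous_snd).matrix_mul
          (continuous_snd.comp continuous_snd))).matrix_elem i j
    exact ContinuousAt.comp (f := fun z => (c z, d z, e z)) this.continuousAt
      (hc.prodMk (hd.prodMk he))
  have contAdj {c : ℂ → Matrix (Fin n) (Fin n) ℂ} (hc : ContinuousAt c 0) :
      ContinuousAt (fun z => (c z).adjugate) 0 :=
    (continuous_id.matrix_adjugate).continuousAt.comp hc
  have hA := cont (toCont hb) (contAdj (toCont ha')) (toCont ha)
  have hB := cont (toCont ha') (toCont hb') (contAdj (toCont hb))
  have key (i j : Fin n) : ∀ᶠ z in 𝓝[≠] (0 : ℂ),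
      ((b z).det • ((a' z).adjugate * a z)) i j =
        z ^ (m j - m' i) * ((a' z).det • (b' z * (b z).adjugate)) i j := by
    filter_upwards [hγ, hγ', self_mem_nhdsWithin] with z h1 h2 hz
    have hz : z ≠ 0 := hz
    have e : ((b z).det • ((a' z).adjugate * a z)) * diagonal (fun i => z ^ (-(m i))) =
        diagonal (fun i => z ^ (-(m' i))) * ((a' z).det • (b' z * (b z).adjugate)) := by
      have e0 := congrArg (fun X => (a' z).adjugate * X * (b z).adjugate) (h1.symm.trans h2)
      have l : (a' z).adjugate * (a z * diagonal (fun i => z ^ (-(m i))) * b z) *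
          (b z).adjugate = (a' z).adjugate * a z * diagonal (fun i => z ^ (-(m i))) *
          (b z * (b z).adjugate) := by simp only [Matrix.mul_assoc]
      have r : (a' z).adjugate * (a' z * diagonal (fun i => z ^ (-(m' i))) * b' z) *
          (b z).adjugate = ((a' z).adjugate * a' z) * (diagonal (fun i => z ^ (-(m' i))) *
          (b' z * (b z).adjugate)) := by simp only [Matrix.mul_assoc]
      rw [l, r, mul_adjugate, adjugate_mul] at e0
      simpa using e0
    have e := congrFun (congrFun e i) j
    rw [mul_diagonal, diagonal_mul] at e
    rw [sub_eq_add_neg, zpow_add₀ hz, mul_assoc, ← e, _root_.zpow_neg]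
    field_simp
  have hdet : ((b 0).det • ((a' 0).adjugate * a 0)).det = 0 := by
    refine Matrix.det_eq_zero_of_zero_block _ k fun i j hi hj => ?_
    have hpos : 0 < m j - m' i := by linarith [hm hj, hm' hi]
    obtain ⟨e, he⟩ := Int.eq_ofNat_of_zero_le hpos.le
    have he0 : e ≠ 0 := by rintro rfl; simp [he] at hpos
    have hpow : Tendsto (fun z : ℂ => z ^ (m j - m' i)) (𝓝[≠] 0) (𝓝 0) := by
      simp only [he, zpow_natCast]
      have := (continuous_pow (M := ℂ) e).tendsto 0
      rw [zero_pow he0] at this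
      exact this.mono_left nhdsWithin_le_nhds
    have hlim := hpow.mul ((hB i j).tendsto.mono_left nhdsWithin_le_nhds)
    rw [zero_mul] at hlim
    exact tendsto_nhds_unique ((hA i j).tendsto.mono_left nhdsWithin_le_nhds)
      (hlim.congr' ((key i j).mono fun z hz => hz.symm))
  rw [Matrix.isUnit_iff_isUnit_det, isUnit_iff_ne_zero] at ua ub ua'
  simp [Matrix.det_adjugate, ua, ub, ua'] at hdet

/-- A finite family of analytic germs, not all zero, is a power of `z` times a family of analytic
germs not all vanishing at `0`. -/
theorem exists_pow_mul_of_analyticAt {ι : Type*} [Finite ι] {f : ι → ℂ → ℂ}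
    (hf : ∀ i, AnalyticAt ℂ (f i) 0) (h0 : ∃ i, ¬ ∀ᶠ z in 𝓝 0, f i z = 0) :
    ∃ (k : ℕ) (g : ι → ℂ → ℂ), (∀ i, AnalyticAt ℂ (g i) 0) ∧ (∃ i, g i 0 ≠ 0) ∧
      ∀ i, ∀ᶠ z in 𝓝 0, f i z = z ^ k * g i z := by
  obtain ⟨i₁, h₁⟩ := h0
  have : Nonempty ι := ⟨i₁⟩
  obtain ⟨i₀, hmin⟩ := Finite.exists_min fun i => analyticOrderAt (f i) 0
  have htop : analyticOrderAt (f i₀) 0 ≠ ⊤ := fun h =>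
    h₁ (analyticOrderAt_eq_top.1 (top_le_iff.1 (h ▸ hmin i₁)))
  obtain ⟨k, hk⟩ := ENat.ne_top_iff_exists.1 htop
  have hg (i) : ∃ g : ℂ → ℂ, AnalyticAt ℂ g 0 ∧ ∀ᶠ z in 𝓝 0, f i z = z ^ k * g z := by
    simpa using (natCast_le_analyticOrderAt (hf i)).1 (hk ▸ hmin i)
  choose g hg hfg using hg
  obtain ⟨g', -, hg0, hfg'⟩ := ((hf i₀).analyticOrderAt_eq_natCast).1 hk.symm
  refine ⟨k, g, hg, ⟨i₀, fun hz => ?_⟩, hfg⟩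
  have hpow : AnalyticAt ℂ (fun z : ℂ => z ^ k) 0 := analyticAt_id.pow k
  have hord : analyticOrderAt (fun z : ℂ => z ^ k) 0 = k :=
    (hpow.analyticOrderAt_eq_natCast).2 ⟨fun _ => 1, analyticAt_const, one_ne_zero, by simp⟩
  have hmul : analyticOrderAt (f i₀) 0 = k + analyticOrderAt (g i₀) 0 := by
    rw [analyticOrderAt_congr (hfg i₀), ← hord]
    exact analyticOrderAt_mul hpow (hg i₀)
  rw [← hk] at hmul
  have : analyticOrderAt (g i₀) 0 = 0 := by
    cases h : analyticOrderAt (g i₀) 0 with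
    | top => simp [h] at hmul
    | coe l => rw [h] at hmul; norm_cast at hmul ⊢; omega
  exact (hg i₀).analyticOrderAt_eq_zero.1 this hz

/-- Smith normal form for matrices of analytic germs. -/
theorem exists_smith_form (n : ℕ) (G : ℂ → Matrix (Fin n) (Fin n) ℂ)
    (hG : ∀ i j, AnalyticAt ℂ (fun z => G z i j) 0) (hU : ∀ᶠ z in 𝓝[≠] (0 : ℂ), IsUnit (G z)) :
    ∃ d : Fin n → ℕ, Monotone d ∧ ∃ a b : ℂ → Matrix (Fin n) (Fin n) ℂ,
      (∀ i j, AnalyticAt ℂ (fun z => a z i j) 0) ∧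
      (∀ i j, AnalyticAt ℂ (fun z => b z i j) 0) ∧
      IsUnit (a 0) ∧ IsUnit (b 0) ∧
      ∀ᶠ z in 𝓝[≠] (0 : ℂ), G z = a z * diagonal (fun i => z ^ d i) * b z := by
  induction n with
  | zero =>
    exact ⟨0, fun i => i.elim0, 1, 1, fun i => i.elim0, fun i => i.elim0, isUnit_one, isUnit_one,
      Eventually.of_forall fun z => Subsingleton.elim _ _⟩
  | succ n ih =>
    obtain ⟨k, g, hg, ⟨⟨i₀, j₀⟩, hp0⟩, hGg⟩ := exists_pow_mul_of_analyticAt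
      (f := fun (p : Fin (n + 1) × Fin (n + 1)) z => G z p.1 p.2) (fun p => hG p.1 p.2) (by
        by_contra! hzero
        have hall := eventually_all.2 hzero
        obtain ⟨z, hz, hu⟩ := ((hall.filter_mono nhdsWithin_le_nhds).and hU).exists
        have : G z = 0 := by ext i j; exact hz (i, j)
        rw [this] at hu
        exact not_isUnit_zero hu)
    let e (i : Fin (n + 1)) : Fin (n + 1) ≃ Unit ⊕ Fin n :=
      (finSuccEquiv' i).trans ((Equiv.optionEquivSumPUnit _).trans (Equiv.sumComm _ _))
    have he (i) : (e i).symm (Sum.inl ()) = i := by simp [e]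
    let H (z : ℂ) : Matrix (Unit ⊕ Fin n) (Unit ⊕ Fin n) ℂ :=
      of fun i j => g ((e i₀).symm i, (e j₀).symm j) z
    have hH (i j) : AnalyticAt ℂ (fun z => H z i j) 0 := hg _
    have hGH : ∀ᶠ z in 𝓝 (0 : ℂ), G z = z ^ k • (H z).submatrix (e i₀) (e j₀) := by
      filter_upwards [eventually_all.2 hGg] with z hz
      ext i j
      simpa [H] using hz (i, j)
    let p (z : ℂ) : ℂ := H z (Sum.inl ()) (Sum.inl ())
    have hp : AnalyticAt ℂ p 0 := hH _ _
    have hpne : p 0 ≠ 0 := by simpa [p, H, he] using hp0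
    have hpev : ∀ᶠ z in 𝓝 (0 : ℂ), p z ≠ 0 := hp.continuousAt.eventually_ne hpne
    let S (z : ℂ) : Matrix (Fin n) (Fin n) ℂ := of fun i j =>
      H z (Sum.inr i) (Sum.inr j) -
        H z (Sum.inr i) (Sum.inl ()) * ((p z)⁻¹ * H z (Sum.inl ()) (Sum.inr j))
    have hS (i j) : AnalyticAt ℂ (fun z => S z i j) 0 :=
      (hH _ _).sub ((hH _ _).mul ((hp.inv hpne).mul (hH _ _)))
    -- A factorization of the Schur complement yields one of the whole block matrix.
    have hfac (z : ℂ) (hz : p z ≠ 0) (x D y : Matrix (Fin n) (Fin n) ℂ) (hxy : S z = x * D * y) :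
        H z = fromBlocks (H z).toBlocks₁₁ 0 (H z).toBlocks₂₁ x * fromBlocks 1 0 0 D *
          fromBlocks 1 ((p z)⁻¹ • (H z).toBlocks₁₂) 0 y := by
      have hE (i j) : H z (Sum.inr i) (Sum.inr j) = H z (Sum.inr i) (Sum.inl ()) *
          ((p z)⁻¹ * H z (Sum.inl ()) (Sum.inr j)) + (x * D * y) i j := by
        rw [← hxy]; simp [S]
      have hpz : H z (Sum.inl ()) (Sum.inl ()) = p z := rfl
      simp only [fromBlocks_multiply]
      ext (i | i) (j | j)
      · simp [Matrix.toBlocks₁₁]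
      · simp [Matrix.toBlocks₁₁, Matrix.toBlocks₁₂, Matrix.mul_apply, hpz, hz]
      · simp [Matrix.toBlocks₂₁]
      · simp [Matrix.toBlocks₂₁, Matrix.toBlocks₁₂, Matrix.mul_apply, hE]
    have hSU : ∀ᶠ z in 𝓝[≠] (0 : ℂ), IsUnit (S z) := by
      filter_upwards [hU, hGH.filter_mono nhdsWithin_le_nhds,
        hpev.filter_mono nhdsWithin_le_nhds] with z hu hz hpz
      have hdet := congrArg det (hfac z hpz 1 (S z) 1 (by simp))
      rw [isUnit_iff_isUnit_det, isUnit_iff_ne_zero] at hu ⊢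
      intro hS0
      have hH0 : (H z).det = 0 := by
        rw [hdet]; simp [det_fromBlocks_zero₂₁, hS0]
      have hsub : ¬ IsUnit ((H z).submatrix (e i₀) (e j₀)) := by
        rw [isUnit_submatrix_equiv, isUnit_iff_isUnit_det, hH0]
        exact not_isUnit_zero
      rw [isUnit_iff_isUnit_det, isUnit_iff_ne_zero, not_not] at hsub
      exact hu (by rw [hz, det_smul, hsub, mul_zero])
    obtain ⟨d, hd, a, b, ha, hb, ua, ub, hab⟩ := ih S hS hSU
    let E := e 0
    refine ⟨fun i => k + (Fin.cons 0 d : Fin (n + 1) → ℕ) i, ?_,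
      fun z => (fromBlocks (H z).toBlocks₁₁ 0 (H z).toBlocks₂₁ (a z)).submatrix (e i₀) E,
      fun z => (fromBlocks 1 ((p z)⁻¹ • (H z).toBlocks₁₂) 0 (b z)).submatrix E (e j₀),
      ?_, ?_, ?_, ?_, ?_⟩
    · intro i j hij
      refine Nat.add_le_add_left ?_ k
      induction i using Fin.cases with
      | zero => simp
      | succ i =>
        induction j using Fin.cases with
        | zero => simp at hij
        | succ j => simpa using hd (Fin.succ_le_succ_iff.1 hij)
    · intro i j
      simp only [submatrix_apply]
      rcases e i₀ i with i | i <;> rcases E j with j | j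
      · exact hH _ _
      · exact analyticAt_const
      · exact hH _ _
      · exact ha _ _
    · intro i j
      simp only [submatrix_apply]
      rcases E i with i | i <;> rcases e j₀ j with j | j
      · exact analyticAt_const
      · exact (hp.inv hpne).mul (hH _ _)
      · exact analyticAt_const
      · exact hb _ _
    · rw [isUnit_submatrix_equiv, isUnit_iff_isUnit_det, det_fromBlocks_zero₁₂, det_unique]
      exact (isUnit_iff_ne_zero.2 hpne).mul ((isUnit_iff_isUnit_det _).1 ua)
    · rw [isUnit_submatrix_equiv, isUnit_iff_isUnit_det, det_fromBlocks_zero₂₁, det_one, one_mul]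
      exact (isUnit_iff_isUnit_det _).1 ub
    · filter_upwards [hab, hGH.filter_mono nhdsWithin_le_nhds,
        hpev.filter_mono nhdsWithin_le_nhds] with z hz hGz hpz
      have hdiag : diagonal (fun i => z ^ (k + (Fin.cons 0 d : Fin (n + 1) → ℕ) i)) =
          z ^ k • (fromBlocks 1 0 0 (diagonal fun i => z ^ d i) :
            Matrix (Unit ⊕ Fin n) (Unit ⊕ Fin n) ℂ).submatrix E E := by
        rw [← diagonal_one, fromBlocks_diagonal, submatrix_diagonal_equiv, ← diagonal_smul]
        congr 1
        ext i
        induction i using Fin.cases with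
        | zero => simp [E, e]
        | succ i => simp [E, e, pow_add, finSuccEquiv'_zero]
      rw [hGz, hdiag, Matrix.mul_smul, Matrix.smul_mul, submatrix_mul_equiv, submatrix_mul_equiv,
        ← hfac z hpz _ _ _ hz]

/-- Every meromorphic family has exponents. -/
theorem IsMeromorphicFamily.exists_isExponents {n : ℕ} {γ : ℂ → Matrix (Fin n) (Fin n) ℂ}
    (hγ : IsMeromorphicFamily n γ) : ∃ m, IsExponents n γ m := by
  obtain ⟨hmer, hU⟩ := hγ
  choose N hN using hmer
  let M := ∑ i, ∑ j, N i j
  have hle (i j) : N i j ≤ M :=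
    (Finset.single_le_sum (f := fun j => N i j) (fun _ _ => Nat.zero_le _)
      (Finset.mem_univ j)).trans
      (Finset.single_le_sum (f := fun i => ∑ j, N i j) (fun _ _ => Nat.zero_le _)
        (Finset.mem_univ i))
  obtain ⟨d, hd, a, b, ha, hb, ua, ub, hab⟩ := exists_smith_form n (fun z => z ^ M • γ z)
    (fun i j => by
      have := ((analyticAt_id (𝕜 := ℂ) (z := (0 : ℂ))).pow (M - N i j)).mul (hN i j)
      refine this.congr (Eventually.of_forall fun z => ?_)
      simp [← mul_assoc, ← pow_add, Nat.sub_add_cancel (hle i j)])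
    (by
      filter_upwards [hU, self_mem_nhdsWithin] with z hu hz
      rw [isUnit_iff_isUnit_det, isUnit_iff_ne_zero] at hu ⊢
      rw [det_smul]
      exact mul_ne_zero (pow_ne_zero _ (pow_ne_zero M hz)) hu)
  refine ⟨fun i => M - d i, fun i j hij => ?_, a, b, ha, hb, ua, ub, ?_⟩
  · have := hd hij
    dsimp only
    omega
  · filter_upwards [hab, self_mem_nhdsWithin] with z h hz
    have hz : z ≠ 0 := hz
    have hdiag : diagonal (fun i => z ^ (-((M : ℤ) - d i))) =
        (z ^ M)⁻¹ • diagonal (fun i => z ^ d i) := by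
      rw [← diagonal_smul]
      congr 1
      ext i
      rw [neg_sub, zpow_sub₀ hz]
      simp [div_eq_mul_inv, mul_comm]
    rw [hdiag, Matrix.mul_smul, Matrix.smul_mul, ← h, smul_smul,
      inv_mul_cancel₀ (pow_ne_zero M hz), one_smul]

theorem exists_unique_exponents (n : ℕ) (γ : ℂ → Matrix (Fin n) (Fin n) ℂ)
    (hγ : IsMeromorphicFamily n γ) :
    ∃! m : Fin n → ℤ, IsExponents n γ m := by
  obtain ⟨m, hm⟩ := hγ.exists_isExponents
  exact ⟨m, hm, fun m' hm' => le_antisymm (hm'.le hm) (hm.le hm')⟩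
end

section
/- Let γ be a meromorphic family with exponents m_1 ≥ … ≥ m_n, and let 1 ≤ j ≤ n. Then the function z ↦ z^{m_1+…+m_j}·Λ^j γ(z), with values in the linear operators on Λ^j ℂ^n (where Λ^j γ(z) is the j-th exterior power of the matrix γ(z)), extends holomorphically to z = 0, and its value at 0 is a nonzero operator. Equivalently, the maximal order of pole at 0 among the matrix entries of Λ^j γ(z) (that is, among the j×j minors of γ(z)) equals m_1+…+m_j. -/
noncomputable section

open scoped Topology

/-- The matrix of the `j`-th exterior power `Λʲ A` of a matrix `A` in the standard basis of
`Λʲ ℂⁿ`: its entries are the `j × j` minors of `A`, indexed by `j`-element subsets of rows and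
columns (taken in increasing order). -/
def minorMatrix (n j : ℕ) (A : Matrix (Fin n) (Fin n) ℂ) :
    Matrix {s : Finset (Fin n) // s.card = j} {s : Finset (Fin n) // s.card = j} ℂ :=
  fun s t =>
    (A.submatrix (fun i : Fin j => ((s.1.orderIsoOfFin s.2 i : s.1) : Fin n))
      (fun i : Fin j => ((t.1.orderIsoOfFin t.2 i : t.1) : Fin n))).det

section MinorMatrix

open Module

/-- The minor matrix of `A` is the matrix of the exterior power of `A`. -/
theorem minorMatrix_eq_toMatrix (n j : ℕ) (A : Matrix (Fin n) (Fin n) ℂ)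
    (s t : Set.powersetCard (Fin n) j) :
    minorMatrix n j A ⟨s.1, s.2⟩ ⟨t.1, t.2⟩ =
      LinearMap.toMatrix ((Pi.basisFun ℂ (Fin n)).exteriorPower j)
        ((Pi.basisFun ℂ (Fin n)).exteriorPower j)
        (exteriorPower.map j (Matrix.toLin' A)) s t := by
  rw [LinearMap.toMatrix_apply, exteriorPower.basis_repr_apply, exteriorPower.basis_apply,
    exteriorPower.ιMulti_family, exteriorPower.map_apply_ιMulti,
    exteriorPower.ιMultiDual_apply_ιMulti, ← Matrix.det_transpose]
  unfold minorMatrix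
  congr 1
  ext i k
  simp [Set.powersetCard.ofFinEmbEquiv_symm_apply]

/-- The Cauchy–Binet formula. -/
theorem minorMatrix_mul (n j : ℕ) (A B : Matrix (Fin n) (Fin n) ℂ) :
    minorMatrix n j (A * B) = minorMatrix n j A * minorMatrix n j B := by
  let e : Set.powersetCard (Fin n) j ≃ {s : Finset (Fin n) // s.card = j} :=
    ⟨fun s => ⟨s.1, s.2⟩, fun s => ⟨s.1, s.2⟩, fun _ => rfl, fun _ => rfl⟩
  have h (A : Matrix (Fin n) (Fin n) ℂ) : minorMatrix n j A =
      Matrix.reindex e e (LinearMap.toMatrix ((Pi.basisFun ℂ (Fin n)).exteriorPower j)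
        ((Pi.basisFun ℂ (Fin n)).exteriorPower j) (exteriorPower.map j (Matrix.toLin' A))) := by
    ext s t
    exact minorMatrix_eq_toMatrix n j A (e.symm s) (e.symm t)
  rw [h, h, h, Matrix.toLin'_mul, exteriorPower.map_comp, LinearMap.toMatrix_comp _
    ((Pi.basisFun ℂ (Fin n)).exteriorPower j)]
  simp [Matrix.submatrix_mul_equiv]

theorem minorMatrix_diagonal (n j : ℕ) (d : Fin n → ℂ) :
    minorMatrix n j (Matrix.diagonal d) =
      Matrix.diagonal (fun s => ∏ i : Fin j, d (s.1.orderEmbOfFin s.2 i)) := by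
  ext s t
  by_cases h : s = t
  · subst h
    rw [Matrix.diagonal_apply_eq, ← Matrix.det_diagonal]
    unfold minorMatrix
    congr 1
    ext i k
    simp [Matrix.diagonal_apply]
  · rw [Matrix.diagonal_apply_ne _ h]
    obtain ⟨x, hxs, hxt⟩ : ∃ x ∈ s.1, x ∉ t.1 := by
      by_contra! hst
      exact h (Subtype.ext (Finset.eq_of_subset_of_card_le hst (by rw [s.2, t.2])))
    rw [← Finset.mem_coe, ← Finset.range_orderEmbOfFin s.1 s.2] at hxs
    obtain ⟨i, rfl⟩ := hxs
    refine Matrix.det_eq_zero_of_row_eq_zero i fun k => Matrix.diagonal_apply_ne _ fun hik => hxt ?_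
    have := Finset.orderEmbOfFin_mem t.1 t.2 k
    rw [← Finset.coe_orderIsoOfFin_apply] at this ⊢
    exact Set.mem_of_eq_of_mem (s := (t.1 : Set (Fin n))) hik this

theorem minorMatrix_one (n j : ℕ) : minorMatrix n j 1 = 1 := by
  rw [← Matrix.diagonal_one, minorMatrix_diagonal]
  simp

theorem IsUnit.minorMatrix {n : ℕ} {A : Matrix (Fin n) (Fin n) ℂ} (hA : IsUnit A) (j : ℕ) :
    IsUnit (minorMatrix n j A) :=
  hA.map (⟨⟨_root_.minorMatrix n j, minorMatrix_one n j⟩, minorMatrix_mul n j⟩ :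
    Matrix (Fin n) (Fin n) ℂ →* _)

theorem AnalyticAt.minorMatrix {n : ℕ} {a : ℂ → Matrix (Fin n) (Fin n) ℂ} {z₀ : ℂ}
    (ha : ∀ i j, AnalyticAt ℂ (fun z => a z i j) z₀) (j : ℕ)
    (s t : {s : Finset (Fin n) // s.card = j}) :
    AnalyticAt ℂ (fun z => minorMatrix n j (a z) s t) z₀ := by
  simp only [_root_.minorMatrix, Matrix.det_apply', Matrix.submatrix_apply]
  exact Finset.analyticAt_fun_sum _ fun σ _ => analyticAt_const.mul
    (Finset.analyticAt_fun_prod _ fun i _ => ha _ _)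

end MinorMatrix

theorem StrictMono.val_le_val_apply {j n : ℕ} {f : Fin j → Fin n} (hf : StrictMono f) (i : Fin j) :
    (i : ℕ) ≤ f i := by
  obtain ⟨i, hi⟩ := i
  induction i with
  | zero => exact Nat.zero_le _
  | succ k ih =>
    have h : f ⟨k, by omega⟩ < f ⟨k + 1, hi⟩ := hf (Fin.mk_lt_mk.mpr k.lt_succ_self)
    exact (ih (by omega)).trans_lt h

theorem Fin.sum_filter_val_lt {M : Type*} [AddCommMonoid M] {j n : ℕ} (hjn : j ≤ n)
    (m : Fin n → M) :
    ∑ i ∈ Finset.univ.filter (fun i : Fin n => (i : ℕ) < j), m i =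
      ∑ i : Fin j, m (Fin.castLE hjn i) := by
  refine (Finset.sum_nbij (Fin.castLE hjn) ?_ ?_ ?_ fun _ _ => rfl).symm
  · simp
  · exact (Fin.castLE_injective hjn).injOn
  · intro i hi
    exact ⟨⟨i, by simpa using hi⟩, by simp, rfl⟩

theorem Antitone.sum_orderEmbOfFin_le {j n : ℕ} (hjn : j ≤ n) {m : Fin n → ℤ} (hm : Antitone m)
    {s : Finset (Fin n)} (hs : s.card = j) :
    ∑ i : Fin j, m (s.orderEmbOfFin hs i) ≤ ∑ i : Fin j, m (Fin.castLE hjn i) :=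
  Finset.sum_le_sum fun i _ => hm (Fin.le_def.mpr
    ((s.orderEmbOfFin hs).strictMono.val_le_val_apply i))

/-- For a meromorphic family `γ` with exponents `m₁ ≥ … ≥ m_n`, the function
`z ↦ z^{m₁+…+m_j}·Λʲγ(z)` (written in the standard basis of `Λʲ ℂⁿ`, i.e. as the matrix of
`j × j` minors of `γ(z)`) extends holomorphically to `0` with a nonzero value there; in other
words, the maximal order of pole at `0` among the `j × j` minors of `γ(z)` is `m₁ + … + m_j`. -/
theorem exteriorPower_order_of_pole (n : ℕ) (γ : ℂ → Matrix (Fin n) (Fin n) ℂ)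
    (hγ : IsMeromorphicFamily n γ) (m : Fin n → ℤ) (hm : IsExponents n γ m)
    (j : ℕ) (hj1 : 1 ≤ j) (hjn : j ≤ n) :
    ∃ g : ℂ → Matrix {s : Finset (Fin n) // s.card = j} {s : Finset (Fin n) // s.card = j} ℂ,
      (∀ s t, AnalyticAt ℂ (fun z => g z s t) 0) ∧
      (∀ᶠ z in 𝓝[≠] (0 : ℂ),
        g z = (z ^ (∑ i ∈ Finset.univ.filter (fun i : Fin n => (i : ℕ) < j), m i)) •
          minorMatrix n j (γ z)) ∧
      g 0 ≠ 0 := by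
  obtain ⟨hmono, a, b, ha, hb, ha0, hb0, hγab⟩ := hm
  rw [Fin.sum_filter_val_lt hjn]
  set N : ℤ := ∑ i : Fin j, m (Fin.castLE hjn i)
  let k (s : {s : Finset (Fin n) // s.card = j}) : ℤ :=
    N - ∑ i : Fin j, m (s.1.orderEmbOfFin s.2 i)
  have hk (s) : 0 ≤ k s := sub_nonneg.mpr (hmono.sum_orderEmbOfFin_le hjn s.2)
  let D (z : ℂ) := Matrix.diagonal fun s => z ^ (k s).toNat
  refine ⟨fun z => minorMatrix n j (a z) * D z * minorMatrix n j (b z), fun s t => ?_, ?_, ?_⟩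
  · have h : (fun z => (minorMatrix n j (a z) * D z * minorMatrix n j (b z)) s t) = fun z =>
        ∑ u, minorMatrix n j (a z) s u * z ^ (k u).toNat * minorMatrix n j (b z) u t := by
      funext z
      rw [Matrix.mul_apply]
      simp only [D, Matrix.mul_diagonal]
    rw [h]
    exact Finset.analyticAt_fun_sum _ fun u _ =>
      ((AnalyticAt.minorMatrix ha j s u).mul (analyticAt_id.fun_pow _)).mul
        (AnalyticAt.minorMatrix hb j u t)
  · filter_upwards [hγab, self_mem_nhdsWithin] with z hz hz0
    have hz0 : z ≠ 0 := hz0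
    have hD : D z = z ^ N • minorMatrix n j (Matrix.diagonal fun i => z ^ (-(m i))) := by
      rw [minorMatrix_diagonal, ← Matrix.diagonal_smul]
      refine congrArg Matrix.diagonal (funext fun s => ?_)
      rw [Pi.smul_apply, smul_eq_mul, ← zpow_natCast, Int.toNat_of_nonneg (hk s), zpow_sub₀ hz0,
        div_eq_mul_inv]
      simp only [zpow_neg, Finset.prod_inv_distrib]
      congr 2
      generalize (Finset.univ : Finset (Fin j)) = u
      induction u using Finset.induction_on with
      | empty => simp
      | insert x u hx ih => rw [Finset.sum_insert hx, Finset.prod_insert hx, zpow_add₀ hz0, ih]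
    rw [hz, minorMatrix_mul, minorMatrix_mul, hD, Matrix.mul_smul, Matrix.smul_mul]
  · intro h
    have hD0 : D 0 = 0 := by
      rw [(hb0.minorMatrix j).mul_left_eq_zero] at h
      rwa [(ha0.minorMatrix j).mul_right_eq_zero] at h
    let s₀ : {s : Finset (Fin n) // s.card = j} :=
      ⟨Finset.univ.map (Fin.castLEEmb hjn), by simp⟩
    have hs₀ : k s₀ = 0 := by
      refine sub_eq_zero.mpr (Finset.sum_congr rfl fun i _ => ?_)
      rw [← Finset.orderEmbOfFin_unique s₀.2 (f := Fin.castLE hjn) (by simp [s₀])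
        (Fin.strictMono_castLE hjn)]
    have := congrFun (congrFun hD0 s₀) s₀
    simp [D, hs₀] at this

end
end
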